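/- Suppose b = +∞, λ > λ*, α ≥ 0, u₀ ≥ 0 and v₀ ≥ 0. Let u be the maximal solution of u'' + α f(u') + β u = λ g(u), u(0) = u₀, u'(0) = v₀, defined on [0, T_∞). Then u(t) → +∞ and u'(t) → +∞ as t → T_∞; moreover, if α = 0 then T_∞ < +∞. -/

import Mathlib

open Filter Topology Set MeasureTheory

section Calculus

variable {x x' : ℝ → ℝ} {a b c m : ℝ}

/-- A differentiable function stays above a level `m` if its derivative is positive whenever
the level is met. -/
lemma le_of_deriv_pos_of_eq (hx : ∀ t ∈ Icc a b, HasDerivWithinAt x (x' t) (Icc a b) t)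
    (ha : m ≤ x a) (hm : ∀ t ∈ Ico a b, x t = m → 0 < x' t) : ∀ t ∈ Icc a b, m ≤ x t := by
  intro t ht
  have key := image_le_of_deriv_right_lt_deriv_boundary (f := fun t => -x t)
    (f' := fun t => -x' t) (a := a) (b := b) (B := fun _ => -m) (B' := fun _ => 0)
    (fun t ht => (hx t ht).continuousWithinAt.neg)
    (fun t ht => ((hx t (Ico_subset_Icc_self ht)).mono_of_mem_nhdsWithin
      (Icc_mem_nhdsGE_of_mem ht)).neg)
    (by simpa using ha) (fun t => hasDerivAt_const t _)
    (fun t ht h => by simpa using hm t ht (by simpa using h)) ht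
  simpa using key

lemma mul_sub_le_of_le_derivWithin (hab : a ≤ b)
    (hx : ∀ t ∈ Icc a b, HasDerivWithinAt x (x' t) (Icc a b) t)
    (hc : ∀ t ∈ Ioo a b, c ≤ x' t) : c * (b - a) ≤ x b - x a := by
  have hd : ∀ t ∈ Ioo a b, HasDerivAt x (x' t) t := fun t ht =>
    (hx t (Ioo_subset_Icc_self ht)).hasDerivAt (Icc_mem_nhds ht.1 ht.2)
  refine (convex_Icc a b).mul_sub_le_image_sub_of_le_deriv
    (fun t ht => (hx t ht).continuousWithinAt) ?_ ?_ a (left_mem_Icc.2 hab) b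
    (right_mem_Icc.2 hab) hab
  · rw [interior_Icc]
    exact fun t ht => (hd t ht).differentiableAt.differentiableWithinAt
  · rw [interior_Icc]
    intro t ht
    rw [(hd t ht).deriv]
    exact hc t ht

lemma le_of_derivWithin_nonneg (hab : a ≤ b)
    (hx : ∀ t ∈ Icc a b, HasDerivWithinAt x (x' t) (Icc a b) t)
    (hc : ∀ t ∈ Ioo a b, 0 ≤ x' t) : x a ≤ x b := by
  have := mul_sub_le_of_le_derivWithin hab hx hc
  linarith

/-- A function on `[0, ∞)` whose derivative is bounded below by a positive constant as long as
it is at most `m` eventually stays above `m`. -/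
lemma exists_forall_ge_of_le_deriv
    (hx : ∀ t ∈ Ici (0 : ℝ), HasDerivWithinAt x (x' t) (Ici 0) t) {t₀ : ℝ} (ht₀ : 0 ≤ t₀)
    (hc : 0 < c) (h : ∀ t ≥ t₀, x t ≤ m → c ≤ x' t) : ∃ t₁ ≥ t₀, ∀ t ≥ t₁, m ≤ x t := by
  have hx' : ∀ r, t₀ ≤ r → ∀ s, ∀ t ∈ Icc r s, HasDerivWithinAt x (x' t) (Icc r s) t :=
    fun r hr s t ht => (hx t (ht₀.trans (hr.trans ht.1))).mono
      fun q hq => ht₀.trans (hr.trans hq.1)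
  obtain ⟨t₁, ht₁, hm⟩ : ∃ t₁ ≥ t₀, m ≤ x t₁ := by
    by_contra! hlt
    obtain ⟨s, hs⟩ : ∃ s, s = t₀ + (m - x t₀) / c := ⟨_, rfl⟩
    have h0 := hlt t₀ le_rfl
    have hst : t₀ ≤ s := by
      have : 0 ≤ (m - x t₀) / c := div_nonneg (by linarith) hc.le
      linarith
    have h1 := mul_sub_le_of_le_derivWithin hst (hx' t₀ le_rfl s)
      (fun t ht => h t ht.1.le (hlt t ht.1.le).le)
    have h2 : c * (s - t₀) = m - x t₀ := by rw [hs]; field_simp; ring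
    linarith [hlt s hst]
  refine ⟨t₁, ht₁, fun t ht => ?_⟩
  exact le_of_deriv_pos_of_eq (hx' t₁ ht₁ t) hm
    (fun q hq he => hc.trans_le (h q (ht₁.trans hq.1) he.le)) t (right_mem_Icc.2 ht)

end Calculus

/-- A solution of an autonomous `C¹` system with a limit at the finite right end of its interval
of definition can be continued. -/
lemma exists_extension_of_tendsto {E : Type*} [NormedAddCommGroup E] [NormedSpace ℝ E]
    [CompleteSpace E] {V : E → E} (hV : ContDiff ℝ 1 V) {T : ℝ} (hT : 0 < T) {y : ℝ → E}
    (hy : ∀ t ∈ Ico 0 T, HasDerivWithinAt y (V (y t)) (Ico 0 T) t) {Y : E}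
    (hlim : Tendsto y (𝓝[<] T) (𝓝 Y)) :
    ∃ T' > T, ∃ z : ℝ → E, z 0 = y 0 ∧
      ∀ t ∈ Ico 0 T', HasDerivWithinAt z (V (z t)) (Ico 0 T') t := by
  obtain ⟨w, hw0, ε, hε, hw⟩ :=
    (hV.contDiffAt (x := Y)).exists_forall_mem_closedBall_exists_eq_forall_mem_Ioo_hasDerivAt₀ T
  obtain ⟨z, hz⟩ : ∃ z : ℝ → E, z = fun t => if t < T then y t else w t := ⟨_, rfl⟩
  have hzl : ∀ t, t < T → z t = y t := fun t ht => by simp [hz, ht]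
  have hzr : ∀ t, T ≤ t → z t = w t := fun t ht => by simp [hz, ht.not_gt]
  have hzT : z T = Y := by rw [hzr T le_rfl, hw0]
  refine ⟨T + ε, by linarith, z, hzl 0 hT, fun t ht => ?_⟩
  rcases lt_trichotomy t T with h | h | h
  · rw [hzl t h]
    refine ((hy t ⟨ht.1, h⟩).congr (fun s hs => hzl s hs.2) (hzl t h)).mono_of_mem_nhdsWithin ?_
    filter_upwards [self_mem_nhdsWithin, mem_nhdsWithin_of_mem_nhds (Iio_mem_nhds h)]
      with s hs hs' using ⟨hs.1, hs'⟩
  · subst h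
    have hd : ∀ s ∈ Ioo 0 t, HasDerivAt z (V (y s)) s := fun s hs =>
      ((hy s ⟨hs.1.le, hs.2⟩).hasDerivAt (Ico_mem_nhds hs.1 hs.2)).congr_of_eventuallyEq
        (by filter_upwards [Iio_mem_nhds hs.2] with r hr using hzl r hr)
    have hmem : Ioo 0 t ∈ 𝓝[<] t := Ioo_mem_nhdsLT hT
    have hleft : HasDerivWithinAt z (V Y) (Iic t) t := by
      refine hasDerivWithinAt_Iic_of_tendsto_deriv (s := Ioo 0 t)
        (fun s hs => (hd s hs).differentiableAt.differentiableWithinAt) ?_ hmem ?_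
      · have h1 : Tendsto z (𝓝[<] t) (𝓝 (z t)) := by
          rw [hzT]
          refine hlim.congr' ?_
          filter_upwards [self_mem_nhdsWithin] with s hs using (hzl s hs).symm
        exact h1.mono_left (nhdsWithin_mono _ fun s hs => hs.2)
      · refine ((hV.continuous.tendsto Y).comp hlim).congr' ?_
        filter_upwards [hmem] with s hs using (hd s hs).deriv.symm
    have hright : HasDerivWithinAt z (V Y) (Ici t) t := by
      have h1 := (hw t ⟨by linarith, by linarith⟩).hasDerivWithinAt (s := Ici t)
      rw [hw0] at h1
      exact h1.congr (fun s hs => hzr s hs) (hzr t le_rfl)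
    have := hleft.union hright
    rw [Iic_union_Ici] at this
    rw [hzT]
    exact this.mono (subset_univ _)
  · rw [hzr t h.le]
    refine ((hw t ⟨by linarith, ht.2⟩).congr_of_eventuallyEq ?_).hasDerivWithinAt
    filter_upwards [Ioi_mem_nhds h] with s hs using hzr s (le_of_lt hs)

section DampedOscillator

variable {h F u v : ℝ → ℝ}

lemma velocity_nonneg (hpos : ∀ x, 0 < h x) (hF0 : F 0 = 0) {s : Set ℝ} (hs : s.OrdConnected)
    (h0 : 0 ∈ s) (hs0 : ∀ t ∈ s, 0 ≤ t) (hv0 : 0 ≤ v 0)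
    (hv : ∀ t ∈ s, HasDerivWithinAt v (h (u t) - F (v t)) s t) : ∀ t ∈ s, 0 ≤ v t := by
  intro t ht
  have hsub : Icc 0 t ⊆ s := hs.out h0 ht
  refine le_of_deriv_pos_of_eq (fun q hq => (hv q (hsub hq)).mono hsub) hv0 ?_ t
    (right_mem_Icc.2 (hs0 t ht))
  intro q _ hq
  rw [hq, hF0, sub_zero]
  exact hpos _

lemma monotoneOn_of_velocity_nonneg {s : Set ℝ} (hs : s.OrdConnected)
    (hu : ∀ t ∈ s, HasDerivWithinAt u (v t) s t) (hv : ∀ t ∈ s, 0 ≤ v t) : MonotoneOn u s := by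
  intro a ha b hb hab
  have hsub : Icc a b ⊆ s := hs.out ha hb
  exact le_of_derivWithin_nonneg hab (fun q hq => (hu q (hsub hq)).mono hsub)
    (fun q hq => hv q (hsub (Ioo_subset_Icc_self hq)))

/-- Friction is bounded on bounded sets, so the forcing eventually dominates it. -/
lemma exists_forall_friction_le (hF : Continuous F) (M : ℝ) :
    ∃ C, ∀ x ∈ Icc 0 M, F x ≤ C := by
  obtain ⟨C, hC⟩ := (isCompact_Icc (a := (0 : ℝ)) (b := M)).bddAbove_image hF.continuousOn
  exact ⟨C, fun x hx => hC (mem_image_of_mem F hx)⟩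

lemma tendsto_atTop_of_global_solution (hpos : ∀ x, 0 < h x) (hF : Continuous F) (hF0 : F 0 = 0)
    {κ : ℝ} (hκ : 0 < κ) (hκh : ∀ x, 0 ≤ x → κ ≤ h x) (hlim : Tendsto h atTop atTop)
    (hu0 : 0 ≤ u 0) (hv0 : 0 ≤ v 0)
    (hu : ∀ t ∈ Ici (0 : ℝ), HasDerivWithinAt u (v t) (Ici 0) t)
    (hv : ∀ t ∈ Ici (0 : ℝ), HasDerivWithinAt v (h (u t) - F (v t)) (Ici 0) t) :
    Tendsto u atTop atTop ∧ Tendsto v atTop atTop := by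
  have hvn : ∀ t ∈ Ici (0 : ℝ), 0 ≤ v t :=
    velocity_nonneg hpos hF0 ordConnected_Ici self_mem_Ici (fun _ ht => ht) hv0 hv
  have hmono := monotoneOn_of_velocity_nonneg ordConnected_Ici hu hvn
  have hun : ∀ t, 0 ≤ t → 0 ≤ u t := fun t ht => hu0.trans (hmono self_mem_Ici ht ht)
  have hut : Tendsto u atTop atTop := by
    obtain ⟨δ, hδ, hFδ⟩ : ∃ δ > 0, ∀ x, |x| < δ → F x < κ / 2 := by
      have : ∀ᶠ x in 𝓝 (0 : ℝ), F x < κ / 2 :=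
        hF.continuousAt.eventually_lt continuousAt_const (by rw [hF0]; linarith)
      obtain ⟨δ, hδ, hb⟩ := Metric.eventually_nhds_iff.1 this
      exact ⟨δ, hδ, fun x hx => hb (by simpa [Real.dist_eq] using hx)⟩
    obtain ⟨t₁, ht₁, hge⟩ := exists_forall_ge_of_le_deriv (m := δ / 2) (c := κ / 2) hv le_rfl
      (by linarith) (fun t ht hvt => by
        have := hFδ (v t) (by rw [abs_of_nonneg (hvn t ht)]; linarith)
        linarith [hκh _ (hun t ht)])
    have hlow : ∀ t, t₁ ≤ t → u t₁ + δ / 2 * (t - t₁) ≤ u t := by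
      intro t ht
      have hsub : Icc t₁ t ⊆ Ici 0 := fun q hq => le_trans ht₁ hq.1
      have := mul_sub_le_of_le_derivWithin ht (fun q hq => (hu q (hsub hq)).mono hsub)
        (fun q hq => hge q hq.1.le)
      linarith
    have hlin : Tendsto (fun t => u t₁ + δ / 2 * (t - t₁)) atTop atTop :=
      tendsto_atTop_add_const_left _ _
        ((tendsto_atTop_add_const_right _ (-t₁) tendsto_id).const_mul_atTop (by positivity))
    refine tendsto_atTop_mono' _ ?_ hlin
    filter_upwards [eventually_ge_atTop t₁] with t ht using hlow t ht
  refine ⟨hut, tendsto_atTop.2 fun M => ?_⟩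
  obtain ⟨C, hC⟩ := exists_forall_friction_le hF M
  obtain ⟨t₀, ht₀⟩ := eventually_atTop.1 ((hlim.comp hut).eventually_ge_atTop (C + 1))
  obtain ⟨t₁, -, hge⟩ := exists_forall_ge_of_le_deriv (m := M) (c := 1) (t₀ := max t₀ 0) hv
    (le_max_right _ _) one_pos (fun t ht hvt => by
      have h1 := ht₀ t ((le_max_left _ _).trans ht)
      have h2 := hC (v t) ⟨hvn t ((le_max_right _ _).trans ht), hvt⟩
      simp only [Function.comp] at h1
      linarith)
  exact eventually_atTop.2 ⟨t₁, hge⟩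

/-- A frictionless system with at least quadratic forcing has no unbounded global solution with
nonnegative velocity. -/
lemma not_tendsto_atTop_of_quadratic_forcing {c : ℝ} (hc : 0 < c)
    (hquad : ∀ᶠ x in atTop, c * x ^ 2 ≤ h x)
    (hu : ∀ t ∈ Ici (0 : ℝ), HasDerivWithinAt u (v t) (Ici 0) t)
    (hv : ∀ t ∈ Ici (0 : ℝ), HasDerivWithinAt v (h (u t)) (Ici 0) t)
    (hvn : ∀ t ∈ Ici (0 : ℝ), 0 ≤ v t) : ¬ Tendsto u atTop atTop := by
  intro hut
  obtain ⟨t₀, ht₀⟩ := eventually_atTop.1 ((hut.eventually hquad).and (eventually_ge_atTop 0))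
  have ht₀0 : 0 ≤ t₀ := (ht₀ t₀ le_rfl).2
  obtain ⟨e, he⟩ : ∃ e, e = v t₀ ^ 2 - 2 * c / 3 * u t₀ ^ 3 := ⟨_, rfl⟩
  have henergy : ∀ t, t₀ ≤ t → e ≤ v t ^ 2 - 2 * c / 3 * u t ^ 3 := by
    intro t ht
    have hsub : Icc t₀ t ⊆ Ici 0 := fun q hq => le_trans ht₀0 hq.1
    rw [he]
    refine le_of_derivWithin_nonneg (x := fun t => v t ^ 2 - 2 * c / 3 * u t ^ 3)
      (x' := fun q => 2 * v q * (h (u q) - c * u q ^ 2)) ht (fun q hq => ?_) (fun q hq => ?_)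
    · have h1 := (hv q (hsub hq)).mono hsub
      have h2 := (hu q (hsub hq)).mono hsub
      refine ((h1.pow 2).sub ((h2.pow 3).const_mul (2 * c / 3))).congr_deriv ?_
      norm_num
      ring
    · have h1 := hvn q (ht₀0.trans hq.1.le)
      have h2 := (ht₀ q hq.1.le).1
      exact mul_nonneg (by linarith) (by linarith)
  have hcube : ∀ᶠ t in atTop, -e ≤ c / 3 * u t ^ 3 :=
    (((tendsto_pow_atTop (three_ne_zero)).comp hut).const_mul_atTop
      (by positivity : 0 < c / 3)).eventually_ge_atTop (-e)
  obtain ⟨t₁, ht₁⟩ := eventually_atTop.1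
    ((hcube.and (hut.eventually_gt_atTop 0)).and (eventually_ge_atTop t₀))
  have ht₁0 : 0 ≤ t₁ := ht₀0.trans (ht₁ t₁ le_rfl).2
  obtain ⟨k, hk⟩ : ∃ k, k = √(c / 3) := ⟨_, rfl⟩
  have hk0 : 0 < k := by rw [hk]; positivity
  have hk2 : k ^ 2 = c / 3 := by rw [hk]; exact Real.sq_sqrt (by positivity)
  have hspeed : ∀ t, t₁ ≤ t → k * (u t * √(u t)) ≤ v t := by
    intro t ht
    obtain ⟨⟨h1, h2⟩, h3⟩ := ht₁ t ht
    refine abs_le_of_sq_le_sq' ?_ (hvn t (ht₀0.trans h3)) |>.2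
    have h4 : (k * (u t * √(u t))) ^ 2 = c / 3 * u t ^ 3 := by
      rw [mul_pow, mul_pow, Real.sq_sqrt h2.le, hk2]
      ring
    rw [h4]
    linarith [henergy t h3]
  obtain ⟨t, ht⟩ : ∃ t, t = t₁ + 2 / k * (√(u t₁))⁻¹ := ⟨_, rfl⟩
  have hu1 := (ht₁ t₁ le_rfl).1.2
  have hle : t₁ ≤ t := by
    have : 0 ≤ 2 / k * (√(u t₁))⁻¹ := by positivity
    linarith
  have hsub : Icc t₁ t ⊆ Ici 0 := fun q hq => le_trans ht₁0 hq.1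
  have hdec := mul_sub_le_of_le_derivWithin (x := fun q => -(√(u q))⁻¹)
    (x' := fun q => v q / (2 * √(u q)) / √(u q) ^ 2) (c := k / 2) hle (fun q hq => by
      have h2 := (ht₁ q hq.1).1.2
      have h1 := ((hu q (hsub hq)).mono hsub).sqrt h2.ne'
      refine (h1.inv (Real.sqrt_pos.2 h2).ne').neg.congr_deriv ?_
      ring) (fun q hq => by
      have h2 := (ht₁ q hq.1.le).1.2
      have h3 := hspeed q hq.1.le
      rw [Real.sq_sqrt h2.le, div_div, le_div_iff₀ (by positivity)]
      linarith)
  have h1 : k / 2 * (t - t₁) = (√(u t₁))⁻¹ := by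
    rw [ht]
    field_simp
    ring
  have h2 : 0 < (√(u t))⁻¹ := inv_pos.2 (Real.sqrt_pos.2 (ht₁ t hle).1.2)
  linarith

lemma tendsto_atTop_of_maximal_solution (hh : ContDiff ℝ 1 h) (hpos : ∀ x, 0 < h x)
    (hF : ContDiff ℝ 1 F) (hF0 : F 0 = 0) (hFn : ∀ x, 0 ≤ x → 0 ≤ F x)
    (hlim : Tendsto h atTop atTop) {T : ℝ} (hT : 0 < T) (hv0 : 0 ≤ v 0)
    (hu : ∀ t ∈ Ico 0 T, HasDerivWithinAt u (v t) (Ico 0 T) t)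
    (hv : ∀ t ∈ Ico 0 T, HasDerivWithinAt v (h (u t) - F (v t)) (Ico 0 T) t)
    (hmax : ∀ T' > T, ¬ ∃ w z : ℝ → ℝ, w 0 = u 0 ∧ z 0 = v 0 ∧ ∀ t ∈ Ico 0 T',
      HasDerivWithinAt w (z t) (Ico 0 T') t ∧
      HasDerivWithinAt z (h (w t) - F (z t)) (Ico 0 T') t) :
    Tendsto u (𝓝[<] T) atTop ∧ Tendsto v (𝓝[<] T) atTop := by
  have hvn : ∀ t ∈ Ico 0 T, 0 ≤ v t :=
    velocity_nonneg hpos hF0 ordConnected_Ico (left_mem_Ico.2 hT) (fun _ ht => ht.1) hv0 hv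
  have hmono := monotoneOn_of_velocity_nonneg ordConnected_Ico hu hvn
  have hsub : ∀ {a b}, a ∈ Ico 0 T → b ∈ Ico 0 T → Icc a b ⊆ Ico 0 T :=
    fun ha hb => ordConnected_Ico.out ha hb
  have hunbdd : ¬ ∃ B, ∀ t ∈ Ico 0 T, u t ≤ B := by
    rintro ⟨B, hB⟩
    obtain ⟨C, hC⟩ := (isCompact_Icc (a := u 0) (b := B)).bddAbove_image
      hh.continuous.continuousOn
    have hderiv : ∀ t ∈ Ico 0 T, h (u t) - F (v t) ≤ C := fun t ht => by
      have h1 : h (u t) ≤ C :=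
        hC (mem_image_of_mem h ⟨hmono (left_mem_Ico.2 hT) ht ht.1, hB t ht⟩)
      linarith [hFn _ (hvn t ht)]
    have hC0 : 0 ≤ C := by
      have h1 : h (u 0) ≤ C := hC (mem_image_of_mem h ⟨le_rfl, hB 0 (left_mem_Ico.2 hT)⟩)
      exact (hpos _).le.trans h1
    have hulim := (hmono.mono Ioo_subset_Ico_self).tendsto_nhdsWithin_Ioo_left
      (nonempty_Ioo.2 hT) ⟨B, by rintro _ ⟨t, ht, rfl⟩; exact hB t (Ioo_subset_Ico_self ht)⟩
    have hwmono : MonotoneOn (fun t => C * t - v t) (Ioo 0 T) := by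
      intro a ha b hb hab
      have hs := hsub (Ioo_subset_Ico_self ha) (Ioo_subset_Ico_self hb)
      refine le_of_derivWithin_nonneg (x := fun t => C * t - v t)
        (x' := fun t => C - (h (u t) - F (v t))) hab (fun q hq => ?_) (fun q hq => ?_)
      · refine (((hasDerivWithinAt_id q _).const_mul C).sub
          ((hv q (hs hq)).mono hs)).congr_deriv ?_
        rw [mul_one]
      · linarith [hderiv q (hs (Ioo_subset_Icc_self hq))]
    have hwlim := hwmono.tendsto_nhdsWithin_Ioo_left (nonempty_Ioo.2 hT) ⟨C * T, by
      rintro _ ⟨t, ht, rfl⟩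
      have h1 := hvn t (Ioo_subset_Ico_self ht)
      have h2 := mul_le_mul_of_nonneg_left ht.2.le hC0
      simp only
      linarith⟩
    have hid : Tendsto (fun t : ℝ => C * t) (𝓝[<] T) (𝓝 (C * T)) :=
      ((continuous_const.mul continuous_id).tendsto T).mono_left nhdsWithin_le_nhds
    have hvlim := hid.sub hwlim
    simp only [sub_sub_cancel] at hvlim
    have hV : ContDiff ℝ 1 (fun q : ℝ × ℝ => (q.2, h q.1 - F q.2)) :=
      contDiff_snd.prodMk ((hh.comp contDiff_fst).sub (hF.comp contDiff_snd))
    obtain ⟨T', hT', z, hz0, hz⟩ := exists_extension_of_tendsto hV hT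
      (y := fun t => (u t, v t)) (fun t ht => (hu t ht).prodMk (hv t ht))
      (hulim.prodMk_nhds hvlim)
    refine hmax T' hT' ⟨fun t => (z t).1, fun t => (z t).2, congrArg Prod.fst hz0, congrArg Prod.snd hz0,
      fun t ht => ⟨?_, ?_⟩⟩
    · exact (ContinuousLinearMap.fst ℝ ℝ ℝ).hasFDerivAt.comp_hasDerivWithinAt t (hz t ht)
    · exact (ContinuousLinearMap.snd ℝ ℝ ℝ).hasFDerivAt.comp_hasDerivWithinAt t (hz t ht)
  have hut : Tendsto u (𝓝[<] T) atTop := by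
    refine tendsto_atTop.2 fun M => ?_
    push Not at hunbdd
    obtain ⟨t₀, ht₀, hM⟩ := hunbdd M
    filter_upwards [Ioo_mem_nhdsLT ht₀.2] with t ht
    exact hM.le.trans (hmono ht₀ ⟨ht₀.1.trans ht.1.le, ht.2⟩ ht.1.le)
  refine ⟨hut, tendsto_atTop.2 fun M => ?_⟩
  obtain ⟨C, hC⟩ := exists_forall_friction_le hF.continuous M
  obtain ⟨l, hl, hlC⟩ := mem_nhdsLT_iff_exists_Ico_subset.1
    ((hlim.comp hut).eventually_ge_atTop (C + 1))
  obtain ⟨t₀, ht₀⟩ : ∃ t₀, t₀ = max l 0 := ⟨_, rfl⟩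
  have hlt₀ : l ≤ t₀ := ht₀ ▸ le_max_left _ _
  have ht₀0 : 0 ≤ t₀ := ht₀ ▸ le_max_right _ _
  have ht₀T : t₀ < T := ht₀ ▸ max_lt hl hT
  have hacc : ∀ t ∈ Ico t₀ T, v t ≤ M → 0 < h (u t) - F (v t) := fun t ht hvt => by
    have h1 : C + 1 ≤ h (u t) := hlC ⟨hlt₀.trans ht.1, ht.2⟩
    have h2 := hC (v t) ⟨hvn t ⟨ht₀0.trans ht.1, ht.2⟩, hvt⟩
    linarith
  obtain ⟨t₁, ht₁, hM⟩ : ∃ t₁ ∈ Ico t₀ T, M ≤ v t₁ := by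
    by_contra! hlt
    refine hunbdd ⟨max (u t₀) (u t₀ + M * (T - t₀)), fun t ht => ?_⟩
    rcases le_total t t₀ with h1 | h1
    · exact (hmono ht ⟨ht₀0, ht₀T⟩ h1).trans (le_max_left _ _)
    · refine le_trans ?_ (le_max_right _ _)
      have hs := hsub ⟨ht₀0, ht₀T⟩ ht
      have h2 := mul_sub_le_of_le_derivWithin (x := fun q => -u q) (x' := fun q => -v q)
        (c := -M) h1 (fun q hq => ((hu q (hs hq)).mono hs).neg)
        (fun q hq => neg_le_neg (hlt q ⟨hq.1.le, hq.2.trans ht.2⟩).le)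
      have h3 : 0 ≤ M := (hvn t₀ ⟨ht₀0, ht₀T⟩).trans (hlt t₀ ⟨le_rfl, ht₀T⟩).le
      have h4 := mul_le_mul_of_nonneg_left (sub_le_sub_right ht.2.le t₀) h3
      linarith
  filter_upwards [Ioo_mem_nhdsLT ht₁.2] with t ht
  have hs := hsub ⟨ht₀0.trans ht₁.1, ht₁.2⟩ (⟨ht₀0.trans (ht₁.1.trans ht.1.le), ht.2⟩)
  exact le_of_deriv_pos_of_eq (fun q hq => (hv q (hs hq)).mono hs) hM
    (fun q hq he => hacc q ⟨ht₁.1.trans hq.1, hq.2.trans ht.2⟩ he.le) t (right_mem_Icc.2 ht.1.le)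

end DampedOscillator

section ConvexForcing

variable {g g' g'' : ℝ → ℝ}

lemma tangent_le_of_strictMono_deriv (hg : ∀ x, HasDerivAt g (g' x) x) (hg' : StrictMono g')
    (p x : ℝ) : g p + g' p * (x - p) ≤ g x := by
  rcases le_total p x with hpx | hpx
  · have := mul_sub_le_of_le_derivWithin (c := g' p) hpx (fun t _ => (hg t).hasDerivWithinAt)
      (fun t ht => hg'.monotone ht.1.le)
    linarith
  · have := mul_sub_le_of_le_derivWithin (c := -g' p) hpx
      (fun t _ => (hg t).neg.hasDerivWithinAt)
      (fun t ht => neg_le_neg (hg'.monotone ht.2.le))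
    simp only [Pi.neg_apply] at this
    linarith

lemma eventually_quadratic_le (hg : ∀ x, HasDerivAt g (g' x) x)
    (hg' : ∀ x, HasDerivAt g' (g'' x) x) {R τ : ℝ} (hτ : 0 < τ) (hR : ∀ x, R < x → τ < g'' x) :
    ∀ᶠ x in atTop, τ / 4 * x ^ 2 ≤ g x := by
  have h1 : ∀ x, R ≤ x → g' R + τ * (x - R) ≤ g' x := fun x hx => by
    have := mul_sub_le_of_le_derivWithin (c := τ) hx (fun t _ => (hg' t).hasDerivWithinAt)
      (fun t ht => (hR t ht.1).le)
    linarith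
  have h2 : ∀ x, R ≤ x → g R + g' R * (x - R) + τ / 2 * (x - R) ^ 2 ≤ g x := fun x hx => by
    have := le_of_derivWithin_nonneg
      (x := fun t => g t - (g' R * (t - R) + τ / 2 * (t - R) ^ 2))
      (x' := fun t => g' t - (g' R + τ * (t - R))) hx (fun t _ => by
        have hd : HasDerivAt (fun t : ℝ => t - R) 1 t := (hasDerivAt_id t).sub_const R
        refine ((hg t).sub ((hd.const_mul (g' R)).add
          ((hd.pow 2).const_mul (τ / 2)))).hasDerivWithinAt.congr_deriv ?_
        norm_num
        ring)
      (fun t ht => sub_nonneg.2 (h1 t ht.1.le))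
    simp only [sub_self] at this
    linarith
  have h3 : Tendsto (fun x : ℝ => x * (τ / 4 * x + (g' R - τ * R))) atTop atTop :=
    tendsto_id.atTop_mul_atTop₀ (tendsto_atTop_add_const_right _ _
      (tendsto_id.const_mul_atTop (by positivity)))
  filter_upwards [eventually_ge_atTop R,
    h3.eventually_ge_atTop (-(g R - g' R * R + τ / 2 * R ^ 2))] with x hx hx'
  nlinarith [h2 x hx]

end ConvexForcing

lemma EReal.comap_coe_nhdsLT_top :
    comap (fun t : ℝ => (t : EReal)) (𝓝[<] (⊤ : EReal)) = atTop := by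
  have : Iio (⊤ : EReal) = {⊤}ᶜ := by ext x; simp [lt_top_iff_ne_top]
  rw [this, EReal.nhdsWithin_top]
  exact comap_map EReal.coe_injective

lemma EReal.comap_coe_nhdsLT_coe (T : ℝ) :
    comap (fun t : ℝ => (t : EReal)) (𝓝[<] (T : EReal)) = 𝓝[<] T := by
  rw [nhdsWithin, comap_inf, comap_principal, nhdsWithin, EReal.isEmbedding_coe.nhds_eq_comap]
  congr 2
  ext t
  simp

theorem blowup_supercritical_binfty
(b : EReal) (hb : (0 : EReal) < b)
    (g g' g'' : ℝ → ℝ)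
    (hgderiv : ∀ u : ℝ, (u : EReal) < b → HasDerivAt g (g' u) u)
    (hgderiv2 : ∀ u : ℝ, (u : EReal) < b → HasDerivAt g' (g'' u) u)
    (hgcont : ContinuousOn g'' {u : ℝ | (u : EReal) < b})
    (hgpos : ∀ u : ℝ, (u : EReal) < b → 0 < g u)
    (hgzero : g 0 = 1)
    (hgprime0 : 0 ≤ g' 0)
    (hgconv : ∀ u : ℝ, (u : EReal) < b → 0 < g'' u)
    (hgtop : b = ⊤ → ∃ R > (0 : ℝ), ∃ τ > (0 : ℝ), ∀ u : ℝ, R < u → τ < g'' u)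
    (hgfin : ∀ b₀ : ℝ, b = (b₀ : EReal) →
      Filter.Tendsto g (nhdsWithin b₀ (Set.Iio b₀)) Filter.atTop ∧
      Filter.Tendsto g' (nhdsWithin b₀ (Set.Iio b₀)) Filter.atTop ∧
      Filter.Tendsto g'' (nhdsWithin b₀ (Set.Iio b₀)) Filter.atTop ∧
      Filter.Tendsto (fun u : ℝ => ∫ s in (0 : ℝ)..u, g s)
        (nhdsWithin b₀ (Set.Iio b₀)) Filter.atTop ∧
      ∃ L : ℝ, L < 0 ∧ Filter.Tendsto
        (fun u : ℝ => (∫ s in (0 : ℝ)..u, g s) - u / 2 * g u)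
        (nhdsWithin b₀ (Set.Iio b₀)) (nhds L))
    (β : ℝ) (hβ : 0 < β)
(f : ℝ → ℝ) (hf : ContDiff ℝ 1 f) (hf0 : f 0 = 0)
    (hfsign : ∀ v : ℝ, v ≠ 0 → 0 < f v * v)
    (hfgrowth : ∃ η > (0 : ℝ), ∃ θ : ℝ, 0 ≤ θ ∧ ∀ v : ℝ, |f v| ≤ η * |v| ^ (θ + 1))
(p : ℝ) (hp0 : 0 < p) (hpb : (p : EReal) < b) (hpeq : g p - p * g' p = 0)
    (hbtop : b = ⊤)
    (lam : ℝ) (hlam : β * p / g p < lam)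
    (α : ℝ) (hα : 0 ≤ α)
    (u₀ v₀ : ℝ) (hu₀ : 0 ≤ u₀) (hv₀ : 0 ≤ v₀)
    (Tinf : EReal) (hT : (0 : EReal) < Tinf)
    (u v : ℝ → ℝ) (hu0 : u 0 = u₀) (hv0 : v 0 = v₀)
    (hsol : ∀ t : ℝ, 0 ≤ t → (t : EReal) < Tinf →
      HasDerivWithinAt u (v t) {s : ℝ | 0 ≤ s ∧ (s : EReal) < Tinf} t ∧
      HasDerivWithinAt v (lam * g (u t) - α * f (v t) - β * u t)
        {s : ℝ | 0 ≤ s ∧ (s : EReal) < Tinf} t)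
    (hmax : ∀ T' : EReal, Tinf < T' → ¬ ∃ w z : ℝ → ℝ, w 0 = u₀ ∧ z 0 = v₀ ∧
      ∀ t : ℝ, 0 ≤ t → (t : EReal) < T' →
        HasDerivWithinAt w (z t) {s : ℝ | 0 ≤ s ∧ (s : EReal) < T'} t ∧
        HasDerivWithinAt z (lam * g (w t) - α * f (z t) - β * w t)
          {s : ℝ | 0 ≤ s ∧ (s : EReal) < T'} t) :
    Filter.Tendsto u
      (Filter.comap (fun t : ℝ => (t : EReal)) (nhdsWithin Tinf (Set.Iio Tinf)))
      Filter.atTop ∧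
    Filter.Tendsto v
      (Filter.comap (fun t : ℝ => (t : EReal)) (nhdsWithin Tinf (Set.Iio Tinf)))
      Filter.atTop ∧
    (α = 0 → Tinf ≠ ⊤) := by
  have hg : ∀ x, HasDerivAt g (g' x) x := fun x => hgderiv x (hbtop ▸ EReal.coe_lt_top x)
  have hg' : ∀ x, HasDerivAt g' (g'' x) x := fun x => hgderiv2 x (hbtop ▸ EReal.coe_lt_top x)
  have hgpos' : ∀ x, 0 < g x := fun x => hgpos x (hbtop ▸ EReal.coe_lt_top x)
  have hmono : StrictMono g' := strictMono_of_deriv_pos fun x => by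
    rw [(hg' x).deriv]
    exact hgconv x (hbtop ▸ EReal.coe_lt_top x)
  have htangent := tangent_le_of_strictMono_deriv hg hmono
  obtain ⟨R, -, τ, hτ, hR⟩ := hgtop hbtop
  obtain ⟨κ, hκ⟩ : ∃ κ, κ = lam - β * p / g p := ⟨_, rfl⟩
  have hκ0 : 0 < κ := by rw [hκ]; linarith
  have hforce : ∀ x, κ * g x ≤ lam * g x - β * x := fun x => by
    have h1 : g' p * x ≤ g x := by linarith [htangent p x]
    have h2 : β * p / g p * (g' p * x) = β * x := by
      have hgp := (hgpos' p).ne'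
      have h3 : g p = p * g' p := by linarith
      field_simp
      rw [h3]
    have h3 : 0 ≤ β * p / g p := div_nonneg (by positivity) (hgpos' p).le
    have h4 := mul_le_mul_of_nonneg_left h1 h3
    rw [hκ]
    linarith
  obtain ⟨h, hh⟩ : ∃ h : ℝ → ℝ, h = fun x => lam * g x - β * x := ⟨_, rfl⟩
  have hhpos : ∀ x, 0 < h x := fun x => by
    rw [hh]
    exact (mul_pos hκ0 (hgpos' x)).trans_le (hforce x)
  have hhκ : ∀ x, 0 ≤ x → κ ≤ h x := fun x hx => by
    have h1 := htangent 0 x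
    have h2 : 1 ≤ g x := by
      have := mul_nonneg hgprime0 hx
      rw [hgzero] at h1
      linarith
    have h3 := hforce x
    rw [hh]
    nlinarith
  have hquad : ∀ᶠ x in atTop, κ * (τ / 4) * x ^ 2 ≤ h x := by
    filter_upwards [eventually_quadratic_le hg hg' hτ hR] with x hx
    rw [hh]
    have := mul_le_mul_of_nonneg_left hx hκ0.le
    linarith [hforce x]
  have hlim : Tendsto h atTop atTop :=
    tendsto_atTop_mono' _ hquad ((tendsto_pow_atTop two_ne_zero).const_mul_atTop (by positivity))
  have hhC : ContDiff ℝ 1 h := by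
    have hgC : ContDiff ℝ 1 g := by
      rw [contDiff_one_iff_deriv]
      refine ⟨fun x => (hg x).differentiableAt, ?_⟩
      rw [show deriv g = g' from funext fun x => (hg x).deriv]
      exact continuous_iff_continuousAt.2 fun x => (hg' x).continuousAt
    rw [hh]
    exact (contDiff_const.mul hgC).sub (contDiff_const.mul contDiff_id)
  have hFC : ContDiff ℝ 1 (fun x => α * f x) := contDiff_const.mul hf
  have hF0 : α * f 0 = 0 := by rw [hf0, mul_zero]
  have hFn : ∀ x, 0 ≤ x → 0 ≤ α * f x := fun x hx => by
    rcases hx.eq_or_lt with rfl | hx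
    · exact hF0.ge
    · exact mul_nonneg hα (pos_of_mul_pos_left (hfsign x hx.ne') hx.le).le
  have hrhs : ∀ x y, lam * g x - α * f y - β * x = h x - α * f y := fun x y => by
    rw [hh]
    ring
  simp only [hrhs] at hsol hmax
  subst hu0 hv0
  induction Tinf with
  | bot => simp at hT
  | top =>
    have hset : {s : ℝ | 0 ≤ s ∧ (s : EReal) < ⊤} = Ici 0 := by
      ext s
      simp [EReal.coe_lt_top]
    rw [hset] at hsol
    have hu := fun t (ht : t ∈ Ici (0 : ℝ)) => (hsol t ht (EReal.coe_lt_top t)).1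
    have hv := fun t (ht : t ∈ Ici (0 : ℝ)) => (hsol t ht (EReal.coe_lt_top t)).2
    obtain ⟨hut, hvt⟩ := tendsto_atTop_of_global_solution hhpos hFC.continuous hF0 hκ0 hhκ hlim
      hu₀ hv₀ hu hv
    rw [EReal.comap_coe_nhdsLT_top]
    refine ⟨hut, hvt, fun hα0 => absurd hut ?_⟩
    have hvn := velocity_nonneg (F := fun x => α * f x) hhpos hF0 ordConnected_Ici self_mem_Ici
      (fun _ ht => ht) hv₀ hv
    refine not_tendsto_atTop_of_quadratic_forcing (by positivity) hquad hu ?_ hvn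
    simpa [hα0] using hv
  | coe T =>
    have hset : ∀ T : ℝ, {s : ℝ | 0 ≤ s ∧ (s : EReal) < T} = Ico 0 T := fun T => by
      ext s
      simp
    rw [hset] at hsol
    have hsol' := fun t (ht : t ∈ Ico 0 T) => hsol t ht.1 (EReal.coe_lt_coe_iff.2 ht.2)
    rw [EReal.comap_coe_nhdsLT_coe]
    obtain ⟨hut, hvt⟩ := tendsto_atTop_of_maximal_solution hhC hhpos hFC hF0 hFn hlim
      (by exact_mod_cast hT) hv₀ (fun t ht => (hsol' t ht).1) (fun t ht => (hsol' t ht).2) (by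
        rintro T' hT' ⟨w, z, hw0, hz0, hwz⟩
        refine hmax T' (EReal.coe_lt_coe_iff.2 hT') ⟨w, z, hw0, hz0, fun t ht ht' => ?_⟩
        rw [hset]
        exact hwz t ⟨ht, EReal.coe_lt_coe_iff.1 ht'⟩)
    exact ⟨hut, hvt, fun _ => EReal.coe_ne_top T⟩
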